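/- arXiv:2412.09471 — 5 statements merged into one kernel-verified Lean document; each statement's English description precedes it below -/
import Mathlib

section
/- Let S be a nonempty finite set, let κ be a real S×S matrix, let c, μ : S → ℝ with c_i > 0, μ_i > 0 and μ_i ≠ c_i for all i, let k : S → ℝ and h ∈ ℝ. Assume D_c⁻¹ − κ is invertible; set Φ := (D_c⁻¹ − κ)⁻¹ and assume Φ − h·k kᵀ is invertible; set A₀ := (I − κ D_c) D_{μ−c}⁻¹ (I − D_μ κ) and B_k := (Φ − h·k kᵀ)⁻¹. Then A₀ + B_k = (D_c⁻¹ − κ) D_c D_{μ−c}⁻¹ D_μ ( I − h·(D_μ⁻¹ − κ) k kᵀ ) B_k. -/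
open Matrix

theorem Matrix.inv_diagonal_of_ne_zero {n K : Type*} [Fintype n] [DecidableEq n] [Field K]
    {d : n → K} (hd : ∀ i, d i ≠ 0) : (diagonal d)⁻¹ = diagonal fun i => (d i)⁻¹ := by
  apply Matrix.inv_eq_left_inv
  rw [diagonal_mul_diagonal, ← diagonal_one]
  congr 1
  funext i
  exact inv_mul_cancel₀ (hd i)

/-- The matrix identity
`A₀ + B_k = (D_c⁻¹ - κ) D_c D_{μ-c}⁻¹ D_μ (I - h (D_μ⁻¹ - κ) k kᵀ) B_k`,
where `A₀ = (I - κ D_c) D_{μ-c}⁻¹ (I - D_μ κ)`, `Φ = (D_c⁻¹ - κ)⁻¹`,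
`B_k = (Φ - h k kᵀ)⁻¹`. -/
theorem stmt3 {S : Type*} [Fintype S] [Nonempty S] [DecidableEq S]
    (κ : Matrix S S ℝ) (c μ k : S → ℝ) (h : ℝ)
    (hc : ∀ i, 0 < c i) (hμ : ∀ i, 0 < μ i) (hne : ∀ i, μ i ≠ c i)
    (Φ A₀ Bk : Matrix S S ℝ)
    (hinv1 : IsUnit ((Matrix.diagonal c)⁻¹ - κ))
    (hΦ : Φ = ((Matrix.diagonal c)⁻¹ - κ)⁻¹)
    (hinv2 : IsUnit (Φ - h • Matrix.vecMulVec k k))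
    (hA₀ : A₀ = ((1 : Matrix S S ℝ) - κ * Matrix.diagonal c) *
        (Matrix.diagonal fun i => μ i - c i)⁻¹ * ((1 : Matrix S S ℝ) - Matrix.diagonal μ * κ))
    (hBk : Bk = (Φ - h • Matrix.vecMulVec k k)⁻¹) :
    A₀ + Bk = ((Matrix.diagonal c)⁻¹ - κ) * Matrix.diagonal c *
      (Matrix.diagonal fun i => μ i - c i)⁻¹ * Matrix.diagonal μ *
      ((1 : Matrix S S ℝ) - h • (((Matrix.diagonal μ)⁻¹ - κ) * Matrix.vecMulVec k k)) * Bk := by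
  have hc' : ∀ i, c i ≠ 0 := fun i => (hc i).ne'
  have hμ' : ∀ i, μ i ≠ 0 := fun i => (hμ i).ne'
  have hd : ∀ i, μ i - c i ≠ 0 := fun i => sub_ne_zero.2 (hne i)
  have hC : (diagonal c)⁻¹ * diagonal c = 1 := by
    simp [inv_diagonal_of_ne_zero hc', hc']
  have hM : diagonal μ * (diagonal μ)⁻¹ = 1 := by
    simp [inv_diagonal_of_ne_zero hμ', hμ']
  have hN : diagonal c * (diagonal fun i => μ i - c i)⁻¹ * diagonal μ *
      ((diagonal c)⁻¹ - (diagonal μ)⁻¹) = 1 := by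
    rw [inv_diagonal_of_ne_zero hc', inv_diagonal_of_ne_zero hμ', inv_diagonal_of_ne_zero hd,
      diagonal_sub, diagonal_mul_diagonal, diagonal_mul_diagonal, diagonal_mul_diagonal,
      ← diagonal_one]
    congr 1
    funext i
    have := hc' i
    have := hμ' i
    have := hd i
    field_simp
  have hPΦ : ((diagonal c)⁻¹ - κ) * Φ = 1 := by
    rw [hΦ]
    exact mul_nonsing_inv _ ((isUnit_iff_isUnit_det _).1 hinv1)
  have hXB : (Φ - h • vecMulVec k k) * Bk = 1 := by
    rw [hBk]
    exact mul_nonsing_inv _ ((isUnit_iff_isUnit_det _).1 hinv2)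
  clear hΦ hBk hinv1 hinv2
  generalize vecMulVec k k = K at *
  generalize (diagonal c)⁻¹ = C' at *
  generalize (diagonal μ)⁻¹ = M' at *
  generalize (diagonal fun i => μ i - c i)⁻¹ = E at *
  generalize diagonal c = C at *
  generalize diagonal μ = M at *
  have hA : A₀ = (C' - κ) * (C * E * M) * (M' - κ) :=
    calc A₀ = (C' * C - κ * C) * E * (M * M' - M * κ) := by rw [hA₀, hC, hM]
      _ = _ := by noncomm_ring
  have hAΦ : A₀ * Φ + 1 = (C' - κ) * (C * E * M) :=
    calc A₀ * Φ + 1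
        = (C' - κ) * (C * E * M) * (M' - κ) * Φ
          + (C' - κ) * (C * E * M * (C' - M')) * Φ := by rw [hA, hN, mul_one, hPΦ]
      _ = (C' - κ) * (C * E * M) * ((C' - κ) * Φ) := by noncomm_ring
      _ = _ := by rw [hPΦ, mul_one]
  calc A₀ + Bk = A₀ * ((Φ - h • K) * Bk) + Bk := by rw [hXB, mul_one]
    _ = (A₀ * Φ + 1 - h • (A₀ * K)) * Bk := by
      rw [← mul_assoc, mul_sub, mul_smul_comm, sub_mul, sub_mul, add_mul, one_mul]
      abel
    _ = ((C' - κ) * (C * E * M) - h • ((C' - κ) * (C * E * M) * (M' - κ) * K)) * Bk := by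
      rw [hAΦ, hA]
    _ = _ := by
      rw [mul_assoc _ _ Bk]
      simp only [← mul_assoc, mul_sub, sub_mul, one_mul, mul_smul_comm, smul_mul_assoc]
end

section
/- Let S be a nonempty finite set, let κ be a real S×S matrix, let c, μ : S → ℝ with 0 < c_i < μ_i for all i. Assume D_c⁻¹ − κ is invertible and set Φ := (D_c⁻¹ − κ)⁻¹. Assume ρ := |c| − (1/2)⟨c, κ c⟩ ≠ 0 and that Φ − c cᵀ/ρ is invertible; set A₀ := (I − κ D_c) D_{μ−c}⁻¹ (I − D_μ κ) and B := (Φ − c cᵀ/ρ)⁻¹. Then A₀ + B = (D_c⁻¹ − κ) D_c D_{μ−c}⁻¹ D_μ ( I − D_μ⁻¹ (I − D_μ κ) c cᵀ / ρ ) B. -/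
open Matrix

/-- If `x` and `y` are inverse to `c` and `m` respectively, and `f`, `p`, `b` are inverse to
`m - c`, `x - k`, `p - r` respectively, then the identity below holds in any ring. -/
theorem product_add_inverse_eq {R : Type*} [Ring R] {k c x m y f p b r : R}
    (hxc : x * c = 1) (hcx : c * x = 1) (hmy : m * y = 1) (hf : f * (m - c) = 1)
    (hp : (x - k) * p = 1) (hb : (p - r) * b = 1) :
    (1 - k * c) * f * (1 - m * k) + b =
      (x - k) * c * f * m * (1 - y * (1 - m * k) * r) * b := by
  have hxk : (x - k) * c = 1 - k * c := by rw [sub_mul, hxc]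
  have hx : (1 - k * c) * x = x - k := by rw [sub_mul, one_mul, mul_assoc, hcx, mul_one]
  have hfactor : (1 - k * c) * f * (1 - m * k) + (x - k) = (1 - k * c) * f * m * (x - k) := by
    calc
      _ = (1 - k * c) * f * (1 - m * k) + (1 - k * c) * (f * (m - c)) * x := by
        rw [hf, mul_one, hx]
      _ = (1 - k * c) * f * (1 - m * k + (m * x - c * x)) := by noncomm_ring
      _ = _ := by rw [hcx]; noncomm_ring
  have hone : (1 - k * c) * f * (1 - m * k) * p + 1 = (1 - k * c) * f * m := by
    calc
      _ = ((1 - k * c) * f * (1 - m * k) + (x - k)) * p := by rw [add_mul, hp]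
      _ = _ := by rw [hfactor, mul_assoc, hp, mul_one]
  symm
  calc
    _ = ((1 - k * c) * f * m - (1 - k * c) * f * (m * y) * (1 - m * k) * r) * b := by
      rw [hxk]; noncomm_ring
    _ = (1 - k * c) * f * (1 - m * k) * ((p - r) * b) + b := by
      rw [← hone, hmy, mul_one]; simp only [mul_sub, sub_mul, add_mul, one_mul, mul_assoc]; abel
    _ = _ := by rw [hb, mul_one]

/-- The matrix identity
`A₀ + B = (D_c⁻¹ - κ) D_c D_{μ-c}⁻¹ D_μ (I - D_μ⁻¹ (I - D_μ κ) c cᵀ / ρ) B`,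
where `ρ = |c| - ½⟨c, κ c⟩`, `A₀ = (I - κ D_c) D_{μ-c}⁻¹ (I - D_μ κ)`,
`Φ = (D_c⁻¹ - κ)⁻¹`, and `B = (Φ - c cᵀ / ρ)⁻¹`. -/
theorem stmt4 {S : Type*} [Fintype S] [Nonempty S] [DecidableEq S]
    (κ : Matrix S S ℝ) (c μ : S → ℝ)
    (hc : ∀ i, 0 < c i) (hcμ : ∀ i, c i < μ i)
    (ρ : ℝ) (hρdef : ρ = (∑ i, c i) - (1 / 2) * (c ⬝ᵥ (κ *ᵥ c))) (hρ : ρ ≠ 0)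
    (Φ A₀ B : Matrix S S ℝ)
    (hinv1 : IsUnit ((Matrix.diagonal c)⁻¹ - κ))
    (hΦ : Φ = ((Matrix.diagonal c)⁻¹ - κ)⁻¹)
    (hinv2 : IsUnit (Φ - ρ⁻¹ • Matrix.vecMulVec c c))
    (hA₀ : A₀ = ((1 : Matrix S S ℝ) - κ * Matrix.diagonal c) *
        (Matrix.diagonal fun i => μ i - c i)⁻¹ * ((1 : Matrix S S ℝ) - Matrix.diagonal μ * κ))
    (hB : B = (Φ - ρ⁻¹ • Matrix.vecMulVec c c)⁻¹) :
    A₀ + B = ((Matrix.diagonal c)⁻¹ - κ) * Matrix.diagonal c *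
      (Matrix.diagonal fun i => μ i - c i)⁻¹ * Matrix.diagonal μ *
      ((1 : Matrix S S ℝ) -
        ρ⁻¹ • ((Matrix.diagonal μ)⁻¹ * ((1 : Matrix S S ℝ) - Matrix.diagonal μ * κ) *
          Matrix.vecMulVec c c)) * B := by
  have hdiag (d : S → ℝ) (hd : ∀ i, 0 < d i) : IsUnit (Matrix.diagonal d).det := by
    rw [Matrix.det_diagonal]
    exact (Finset.prod_pos fun i _ => hd i).ne'.isUnit
  have hdc := hdiag c hc
  have hdμ := hdiag μ fun i => (hc i).trans (hcμ i)
  have hdsub := hdiag (fun i => μ i - c i) fun i => sub_pos.2 (hcμ i)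
  have hsub : (Matrix.diagonal fun i => μ i - c i) = Matrix.diagonal μ - Matrix.diagonal c :=
    (Matrix.diagonal_sub μ c).symm
  subst hA₀ hB
  rw [← Matrix.mul_smul]
  refine product_add_inverse_eq (Matrix.nonsing_inv_mul _ hdc) (Matrix.mul_nonsing_inv _ hdc)
    (Matrix.mul_nonsing_inv _ hdμ) ?_ (p := Φ) ?_
    (Matrix.mul_nonsing_inv _ ((Matrix.isUnit_iff_isUnit_det _).1 hinv2))
  · rw [← hsub]
    exact Matrix.nonsing_inv_mul _ hdsub
  · rw [hΦ]
    exact Matrix.mul_nonsing_inv _ ((Matrix.isUnit_iff_isUnit_det _).1 hinv1)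
end

section
/- Let S be a nonempty finite set, let κ be a symmetric real S×S matrix, let c, μ : S → ℝ with 0 < c_i < μ_i for all i, let k : S → ℝ and h > 0. Assume D_c⁻¹ − κ is positive definite; set Φ := (D_c⁻¹ − κ)⁻¹, A₀ := (I − κ D_c) D_{μ−c}⁻¹ (I − D_μ κ), A := (1/2)(A₀ + A₀ᵀ). Assume Φ − h·k kᵀ is positive definite and set B_k := (Φ − h·k kᵀ)⁻¹. If h·⟨k, (D_μ⁻¹ − κ) k⟩ < 1, then A + B_k is positive definite. -/
open Matrix

namespace Matrix

variable {S : Type*} [Fintype S] [DecidableEq S]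

theorem inv_diagonal_of_ne_zero_s5 {v : S → ℝ} (hv : ∀ i, v i ≠ 0) :
    (diagonal v)⁻¹ = diagonal fun i => (v i)⁻¹ := by
  apply inv_eq_right_inv
  simp [diagonal_mul_diagonal, hv]

/-- The product `(I - κ D_c) D_{μ-c}⁻¹ (I - D_μ κ)` in terms of `M = D_c⁻¹ - κ`. -/
theorem one_sub_mul_inv_mul_one_sub (κ : Matrix S S ℝ) {c μ : S → ℝ}
    (hc : ∀ i, 0 < c i) (hcμ : ∀ i, c i < μ i) :
    (1 - κ * diagonal c) * (diagonal fun i => μ i - c i)⁻¹ * (1 - diagonal μ * κ) =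
      ((diagonal c)⁻¹ - κ) * diagonal (fun i => c i * μ i / (μ i - c i)) *
        ((diagonal c)⁻¹ - κ) - ((diagonal c)⁻¹ - κ) := by
  have hc' : ∀ i, c i ≠ 0 := fun i => (hc i).ne'
  have hμ' : ∀ i, μ i ≠ 0 := fun i => ((hc i).trans (hcμ i)).ne'
  have hd : ∀ i, μ i - c i ≠ 0 := fun i => (sub_pos.2 (hcμ i)).ne'
  rw [inv_diagonal_of_ne_zero_s5 hc', inv_diagonal_of_ne_zero_s5 hd]
  set M := diagonal (fun i => (c i)⁻¹) - κ with hM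
  have hleft : 1 - κ * diagonal c = M * diagonal c := by
    simp [hM, sub_mul, diagonal_mul_diagonal, hc']
  have hright : 1 - diagonal μ * κ =
      diagonal μ * (M - diagonal fun i => (c i)⁻¹ - (μ i)⁻¹) := by
    have : M - diagonal (fun i => (c i)⁻¹ - (μ i)⁻¹) = diagonal (fun i => (μ i)⁻¹) - κ := by
      rw [← diagonal_sub, hM]
      abel
    simp [this, mul_sub, diagonal_mul_diagonal, hμ']
  have hW : diagonal c * diagonal (fun i => (μ i - c i)⁻¹) * diagonal μ =
      diagonal fun i => c i * μ i / (μ i - c i) := by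
    simp only [diagonal_mul_diagonal]
    congr 1
    ext i
    ring
  have hWE : diagonal (fun i => c i * μ i / (μ i - c i)) *
      diagonal (fun i => (c i)⁻¹ - (μ i)⁻¹) = 1 := by
    rw [diagonal_mul_diagonal, ← diagonal_one]
    congr 1
    ext i
    have := hc' i
    have := hμ' i
    have := hd i
    field_simp
  calc _ = M * (diagonal c * diagonal (fun i => (μ i - c i)⁻¹) * diagonal μ) *
        (M - diagonal fun i => (c i)⁻¹ - (μ i)⁻¹) := by
        rw [hleft, hright]
        simp only [Matrix.mul_assoc]
    _ = _ := by rw [hW, mul_sub, Matrix.mul_assoc M _ (diagonal _), hWE, mul_one]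

/-- Subtracting a positive semidefinite matrix increases the inverse of a positive definite one. -/
theorem PosDef.posSemidef_inv_sub_inv {P R : Matrix S S ℝ} (hP : P.PosDef)
    (hR : R.PosSemidef) (hPR : (P - R).PosDef) : ((P - R)⁻¹ - P⁻¹).PosSemidef := by
  have hP' := (isUnit_iff_isUnit_det _).1 hP.isUnit
  have hPR' := (isUnit_iff_isUnit_det _).1 hPR.isUnit
  set B := (P - R)⁻¹
  set M := P⁻¹
  have hMR : B = M + M * R * B := by
    have : M * P * B = M * (P - R) * B + M * R * B := by noncomm_ring
    rwa [nonsing_inv_mul _ hP', one_mul, Matrix.mul_assoc M (P - R), mul_nonsing_inv _ hPR',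
      mul_one] at this
  have hRM : B = M + B * R * M := by
    have : B * (P * M) = B * (P - R) * M + B * R * M := by noncomm_ring
    rwa [mul_nonsing_inv _ hP', mul_one, nonsing_inv_mul _ hPR', one_mul] at this
  have hM : Mᴴ = M := hP.inv.isHermitian
  have key : B - M = M * R * Mᴴ + (M * R) * B * (M * R)ᴴ := by
    rw [conjTranspose_mul, hM, hR.isHermitian.eq]
    calc B - M = M * R * B := by rw [sub_eq_iff_eq_add, add_comm]; exact hMR
      _ = M * R * (M + B * R * M) := by rw [← hRM]
      _ = _ := by noncomm_ring
  rw [key]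
  exact (hR.mul_mul_conjTranspose_same M).add (hPR.inv.posSemidef.mul_mul_conjTranspose_same _)

end Matrix

/-- If `h ⟨k, (D_μ⁻¹ - κ) k⟩ < 1` (with κ symmetric, `0 < c < μ`, `h > 0`,
`D_c⁻¹ - κ` positive definite and `Φ - h k kᵀ` positive definite), then `A + B_k`
is positive definite, where `Φ = (D_c⁻¹ - κ)⁻¹`,
`A₀ = (I - κ D_c) D_{μ-c}⁻¹ (I - D_μ κ)`, `A = ½(A₀ + A₀ᵀ)`, `B_k = (Φ - h k kᵀ)⁻¹`. -/
theorem stmt5 {S : Type*} [Fintype S] [Nonempty S] [DecidableEq S]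
    (κ : Matrix S S ℝ) (hκ : κ.IsSymm)
    (c μ k : S → ℝ) (h : ℝ)
    (hc : ∀ i, 0 < c i) (hcμ : ∀ i, c i < μ i) (hh : 0 < h)
    (Φ A₀ A Bk : Matrix S S ℝ)
    (hpd1 : ((Matrix.diagonal c)⁻¹ - κ).PosDef)
    (hΦ : Φ = ((Matrix.diagonal c)⁻¹ - κ)⁻¹)
    (hA₀ : A₀ = ((1 : Matrix S S ℝ) - κ * Matrix.diagonal c) *
        (Matrix.diagonal fun i => μ i - c i)⁻¹ * ((1 : Matrix S S ℝ) - Matrix.diagonal μ * κ))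
    (hA : A = (1 / 2 : ℝ) • (A₀ + A₀ᵀ))
    (hpd2 : (Φ - h • Matrix.vecMulVec k k).PosDef)
    (hBk : Bk = (Φ - h • Matrix.vecMulVec k k)⁻¹)
    (hlt : h * (k ⬝ᵥ (((Matrix.diagonal μ)⁻¹ - κ) *ᵥ k)) < 1) :
    (A + Bk).PosDef := by
  have hM := hpd1
  set M := (diagonal c)⁻¹ - κ with hMdef
  have hMsymm : Mᵀ = M := by simpa using hM.isHermitian.eq
  have hA' : A = M * diagonal (fun i => c i * μ i / (μ i - c i)) * M - M := by
    have hA₀' := hA₀.trans (one_sub_mul_inv_mul_one_sub κ hc hcμ)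
    rw [← hMdef] at hA₀'
    have hA₀symm : A₀ᵀ = A₀ := by
      rw [hA₀']
      simp [hMsymm, Matrix.mul_assoc]
    rw [hA, hA₀symm, ← two_smul ℝ A₀, smul_smul, ← hA₀']
    norm_num
  have hW : (diagonal fun i => c i * μ i / (μ i - c i)).PosDef :=
    PosDef.diagonal fun i =>
      div_pos (mul_pos (hc i) ((hc i).trans (hcμ i))) (sub_pos.2 (hcμ i))
  have hMWM : (M * diagonal (fun i => c i * μ i / (μ i - c i)) * M).PosDef := by
    have := hW.conjTranspose_mul_mul_same (mulVec_injective_of_isUnit hM.isUnit)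
    rwa [hM.isHermitian.eq] at this
  have hR : (h • vecMulVec k k).PosSemidef := by
    simpa using (posSemidef_vecMulVec_self_star k).smul hh.le
  have hΦpd : Φ.PosDef := hΦ ▸ hM.inv
  have hBM := hΦpd.posSemidef_inv_sub_inv hR hpd2
  rw [← hBk, hΦ, nonsing_inv_nonsing_inv _ ((isUnit_iff_isUnit_det _).1 hM.isUnit)] at hBM
  have : A + Bk = M * diagonal (fun i => c i * μ i / (μ i - c i)) * M + (Bk - M) := by
    rw [hA']
    abel
  exact this ▸ hMWM.add_posSemidef hBM
end

section
/- Let S be a nonempty finite set, let κ be a symmetric real S×S matrix, let c, μ : S → ℝ with 0 < c_i < μ_i for all i. Assume D_c⁻¹ − κ is positive definite; set Φ := (D_c⁻¹ − κ)⁻¹, A₀ := (I − κ D_c) D_{μ−c}⁻¹ (I − D_μ κ), A := (1/2)(A₀ + A₀ᵀ). Assume ⟨c, κ c⟩ ≥ 0, ρ := |c| − (1/2)⟨c, κ c⟩ > 0, and that Φ − c cᵀ/ρ is positive definite; set B := (Φ − c cᵀ/ρ)⁻¹. Then A + B is positive definite. -/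
open Matrix

/-- Inversion is antitone on positive definite matrices: if `P` is positive definite and
`M⁻¹ - P` is positive semidefinite, then `P⁻¹ - M` is positive semidefinite. -/
theorem Matrix.PosDef.posSemidef_inv_sub {S : Type*} [Fintype S] [DecidableEq S]
    {M P : Matrix S S ℝ} (hM : M.PosDef) (hP : P.PosDef) (h : (M⁻¹ - P).PosSemidef) :
    (P⁻¹ - M).PosSemidef := by
  have hMu : IsUnit M.det := hM.isUnit.map Matrix.detMonoidHom
  have hPu : IsUnit P.det := hP.isUnit.map Matrix.detMonoidHom
  have key : P⁻¹ - M = (1 - P * M)ᴴ * P⁻¹ * (1 - P * M) + Mᴴ * (M⁻¹ - P) * M := by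
    rw [conjTranspose_sub, conjTranspose_mul, conjTranspose_one, hM.isHermitian.eq,
      hP.isHermitian.eq]
    have e₁ : (1 - M * P) * P⁻¹ = P⁻¹ - M := by
      rw [sub_mul, one_mul, mul_assoc, mul_nonsing_inv _ hPu, mul_one]
    have e₂ : M * (M⁻¹ - P) = 1 - M * P := by
      rw [mul_sub, mul_nonsing_inv _ hMu]
    have e₃ : P⁻¹ * (P * M) = M := by
      rw [← mul_assoc, nonsing_inv_mul _ hPu, one_mul]
    rw [e₁, e₂, sub_mul, mul_sub, mul_sub, e₃, sub_mul]
    simp only [mul_one, one_mul, mul_assoc]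
    abel
  rw [key]
  exact (hP.inv.posSemidef.conjTranspose_mul_mul_same _).add (h.conjTranspose_mul_mul_same _)

/-- With `M = D_c⁻¹ - κ`, the matrix `(I - κ D_c) D_{μ-c}⁻¹ (I - D_μ κ)` equals
`M D M - M` for the diagonal matrix `D` with entries `c_i μ_i / (μ_i - c_i)`. -/
theorem Matrix.one_sub_mul_diagonal_mul_eq {S : Type*} [Fintype S] [DecidableEq S]
    (κ : Matrix S S ℝ) (c μ : S → ℝ) (hc : ∀ i, c i ≠ 0) (hcμ : ∀ i, μ i - c i ≠ 0) :
    (1 - κ * diagonal c) * (diagonal fun i => μ i - c i)⁻¹ * (1 - diagonal μ * κ) =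
      ((diagonal c)⁻¹ - κ) * (diagonal fun i => c i * μ i / (μ i - c i)) *
        ((diagonal c)⁻¹ - κ) - ((diagonal c)⁻¹ - κ) := by
  have hinv : ∀ v : S → ℝ, (∀ i, v i ≠ 0) → (diagonal v)⁻¹ = diagonal fun i => (v i)⁻¹ := by
    intro v hv
    refine inv_eq_left_inv ?_
    rw [diagonal_mul_diagonal, ← diagonal_one]
    congr 1
    ext i
    exact inv_mul_cancel₀ (hv i)
  rw [hinv _ hc, hinv _ hcμ]
  set C : Matrix S S ℝ := diagonal fun i => (c i)⁻¹ with hC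
  set M : Matrix S S ℝ := C - κ with hM
  have e₁ : 1 - κ * diagonal c = M * diagonal c := by
    rw [hM, sub_mul, hC, diagonal_mul_diagonal, ← diagonal_one]
    congr 2
    ext i
    exact (inv_mul_cancel₀ (hc i)).symm
  have e₂ : 1 - diagonal μ * κ = diagonal μ * M - diagonal fun i => (μ i - c i) / c i := by
    have : (1 : Matrix S S ℝ) = diagonal μ * C - diagonal fun i => (μ i - c i) / c i := by
      rw [hC, diagonal_mul_diagonal, diagonal_sub, ← diagonal_one]
      congr 1
      ext i
      have := hc i
      field_simp
      ring
    rw [hM, mul_sub, sub_right_comm, ← this]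
  have e₃ : diagonal c * (diagonal fun i => (μ i - c i)⁻¹) * diagonal μ =
      diagonal fun i => c i * μ i / (μ i - c i) := by
    rw [diagonal_mul_diagonal, diagonal_mul_diagonal]
    congr 1
    ext i
    ring
  have e₄ : diagonal c * (diagonal fun i => (μ i - c i)⁻¹) *
      (diagonal fun i => (μ i - c i) / c i) = 1 := by
    rw [diagonal_mul_diagonal, diagonal_mul_diagonal, ← diagonal_one]
    congr 1
    ext i
    have h₁ := hc i
    have h₂ := hcμ i
    field_simp
  rw [e₁, e₂, mul_assoc M, mul_assoc M, mul_sub, e₄, ← mul_assoc _ (diagonal μ), e₃, mul_sub,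
    mul_one, mul_assoc]

/-- With κ symmetric, `0 < c < μ`, `D_c⁻¹ - κ` positive definite, `⟨c, κ c⟩ ≥ 0`,
`ρ = |c| - ½⟨c, κ c⟩ > 0` and `Φ - c cᵀ/ρ` positive definite, the matrix `A + B`
is positive definite, where `Φ = (D_c⁻¹ - κ)⁻¹`,
`A₀ = (I - κ D_c) D_{μ-c}⁻¹ (I - D_μ κ)`, `A = ½(A₀ + A₀ᵀ)`, `B = (Φ - c cᵀ/ρ)⁻¹`. -/
theorem stmt6 {S : Type*} [Fintype S] [Nonempty S] [DecidableEq S]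
    (κ : Matrix S S ℝ) (hκ : κ.IsSymm)
    (c μ : S → ℝ)
    (hc : ∀ i, 0 < c i) (hcμ : ∀ i, c i < μ i)
    (hquad : 0 ≤ c ⬝ᵥ (κ *ᵥ c))
    (ρ : ℝ) (hρdef : ρ = (∑ i, c i) - (1 / 2) * (c ⬝ᵥ (κ *ᵥ c))) (hρ : 0 < ρ)
    (Φ A₀ A B : Matrix S S ℝ)
    (hpd1 : ((Matrix.diagonal c)⁻¹ - κ).PosDef)
    (hΦ : Φ = ((Matrix.diagonal c)⁻¹ - κ)⁻¹)
    (hA₀ : A₀ = ((1 : Matrix S S ℝ) - κ * Matrix.diagonal c) *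
        (Matrix.diagonal fun i => μ i - c i)⁻¹ * ((1 : Matrix S S ℝ) - Matrix.diagonal μ * κ))
    (hA : A = (1 / 2 : ℝ) • (A₀ + A₀ᵀ))
    (hpd2 : (Φ - ρ⁻¹ • Matrix.vecMulVec c c).PosDef)
    (hB : B = (Φ - ρ⁻¹ • Matrix.vecMulVec c c)⁻¹) :
    (A + B).PosDef := by
  set M := (diagonal c)⁻¹ - κ with hM
  have hMu : IsUnit M.det := hpd1.isUnit.map Matrix.detMonoidHom
  set D : Matrix S S ℝ := diagonal fun i => c i * μ i / (μ i - c i) with hD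
  have hDpd : D.PosDef := PosDef.diagonal fun i =>
    div_pos (mul_pos (hc i) ((hc i).trans (hcμ i))) (sub_pos.2 (hcμ i))
  have hMt : Mᵀ = M := by
    simpa only [conjTranspose_eq_transpose_of_trivial] using hpd1.isHermitian.eq
  have hA' : A = M * D * M - M := by
    have hA₀' : A₀ = M * D * M - M := hA₀.trans
      (one_sub_mul_diagonal_mul_eq κ c μ (fun i => (hc i).ne') fun i => (sub_pos.2 (hcμ i)).ne')
    have hsymm : A₀ᵀ = A₀ := by
      rw [hA₀', transpose_sub, transpose_mul, transpose_mul, hMt, hD, diagonal_transpose,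
        mul_assoc]
    rw [hA, hsymm, ← two_smul ℝ A₀, smul_smul, hA₀']
    norm_num
  have hMDM : (M * D * M).PosDef := by
    have := hDpd.conjTranspose_mul_mul_same (B := M)
      (mulVec_injective_iff_isUnit.2 hpd1.isUnit)
    rwa [hpd1.isHermitian.eq] at this
  have hBM : (B - M).PosSemidef := by
    rw [hB]
    refine hpd1.posSemidef_inv_sub hpd2 ?_
    rw [hΦ, sub_sub_cancel]
    have := (posSemidef_vecMulVec_self_star c).smul (inv_nonneg.2 hρ.le)
    rwa [star_trivial] at this
  have hsum : A + B = M * D * M + (B - M) := by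
    rw [hA']
    abel
  rw [hsum]
  exact hMDM.add_posSemidef hBM
end

section
/- Let θ > 0 and ξ > 0, and let (a_n)_{n≥1} be a sequence of positive reals with a_n → ∞ and a_n/√n → 0. For each n let N_n be a Poisson random variable with mean θn. Then limsup_{n→∞} (1/a_n²) · log P( |N_n − θn| > ξ a_n √n ) ≤ −ξ²/(2θ). -/
open Filter MeasureTheory ProbabilityTheory

lemma hasSum_poisson_exp_mul_sub (r u : ℝ) :
    HasSum (fun j : ℕ => Real.exp (-r) * r ^ j / (Nat.factorial j) * Real.exp (u * (j - r)))
      (Real.exp (r * (Real.exp u - 1 - u))) := by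
  have h := (NormedSpace.expSeries_div_hasSum_exp (r * Real.exp u)).mul_left
    (Real.exp (-r) * Real.exp (-(u * r)))
  rw [← Real.exp_eq_exp_ℝ] at h
  convert! h using 1
  · ext j
    rw [mul_sub, sub_eq_add_neg, Real.exp_add (u * j), mul_comm u (j : ℝ), Real.exp_nat_mul,
      mul_pow]
    ring
  · rw [← Real.exp_add, ← Real.exp_add]
    ring_nf

lemma exp_sub_one_sub_le {u s : ℝ} (hu : |u| = s) (hs : s ≤ 1) :
    Real.exp u - 1 - u ≤ s ^ 2 / 2 + s ^ 3 := by
  have h := Real.exp_bound (x := u) (by rwa [hu]) (n := 3) (by norm_num)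
  have h0 : 0 ≤ s := hu ▸ abs_nonneg u
  have hsq : u ^ 2 = s ^ 2 := by rw [← hu, sq_abs]
  have h' := le_of_abs_le h
  rw [hu] at h'
  norm_num [Finset.sum_range_succ, Nat.factorial, hsq] at h'
  linarith [pow_nonneg h0 3]

/-- A Chernoff bound for a (not necessarily measurable) function with Poisson point masses. -/
lemma measure_abs_sub_gt_le_of_poisson {Ω : Type*} [MeasurableSpace Ω] (μ : Measure Ω)
    (X : Ω → ℕ) {r s : ℝ} (hr : 0 ≤ r) (hs0 : 0 ≤ s) (hs1 : s ≤ 1) (t : ℝ)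
    (hX : ∀ j : ℕ, μ {ω | X ω = j} =
      ENNReal.ofReal (Real.exp (-r) * r ^ j / (Nat.factorial j))) :
    μ {ω | |(X ω : ℝ) - r| > t} ≤
      ENNReal.ofReal (2 * Real.exp (r * (s ^ 2 / 2 + s ^ 3) - s * t)) := by
  set p : ℕ → ℝ := fun j => Real.exp (-r) * r ^ j / (Nat.factorial j)
  have hp : ∀ j, 0 ≤ p j := fun j => by positivity
  set g : ℕ → ℝ := fun j =>
    (p j * Real.exp (s * (j - r)) + p j * Real.exp (-s * (j - r))) * Real.exp (-(s * t))
  have hg0 : ∀ j, 0 ≤ g j := fun j => by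
    have := hp j
    positivity
  have hg := ((hasSum_poisson_exp_mul_sub r s).add
    (hasSum_poisson_exp_mul_sub r (-s))).mul_right (Real.exp (-(s * t)))
  have hpt : ∀ j : ℕ, μ ({ω | X ω = j} ∩ {ω | |(X ω : ℝ) - r| > t}) ≤ ENNReal.ofReal (g j) := by
    intro j
    by_cases hj : |(j : ℝ) - r| > t
    · refine (measure_mono Set.inter_subset_left).trans ((hX j).trans_le ?_)
      refine ENNReal.ofReal_le_ofReal ?_
      have key : 1 ≤ (Real.exp (s * (j - r)) + Real.exp (-s * (j - r))) * Real.exp (-(s * t)) := by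
        rw [add_mul, ← Real.exp_add, ← Real.exp_add]
        rcases lt_abs.1 hj with h | h
        · have := Real.one_le_exp (x := s * (j - r) + -(s * t)) (by nlinarith)
          linarith [Real.exp_pos (-s * (j - r) + -(s * t))]
        · have := Real.one_le_exp (x := -s * (j - r) + -(s * t)) (by nlinarith)
          linarith [Real.exp_pos (s * (j - r) + -(s * t))]
      have := mul_le_mul_of_nonneg_left key (hp j)
      simp only [g]
      linarith
    · have : {ω | X ω = j} ∩ {ω | |(X ω : ℝ) - r| > t} = ∅ := by
        ext ω
        simp only [Set.mem_inter_iff, Set.mem_ofPred_eq, Set.mem_empty_iff_false, iff_false]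
        rintro ⟨rfl, h⟩
        exact hj h
      simp [this]
  calc μ {ω | |(X ω : ℝ) - r| > t}
      ≤ μ (⋃ j : ℕ, {ω | X ω = j} ∩ {ω | |(X ω : ℝ) - r| > t}) :=
        measure_mono fun ω hω => Set.mem_iUnion.2 ⟨X ω, rfl, hω⟩
    _ ≤ ∑' j, μ ({ω | X ω = j} ∩ {ω | |(X ω : ℝ) - r| > t}) := measure_iUnion_le _
    _ ≤ ∑' j, ENNReal.ofReal (g j) := ENNReal.tsum_le_tsum hpt
    _ = ENNReal.ofReal (∑' j, g j) := (ENNReal.ofReal_tsum_of_nonneg hg0 hg.summable).symm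
    _ ≤ _ := by
        refine ENNReal.ofReal_le_ofReal ?_
        rw [hg.tsum_eq, add_mul, ← Real.exp_add, ← Real.exp_add, two_mul]
        have h1 := mul_le_mul_of_nonneg_left (exp_sub_one_sub_le (abs_of_nonneg hs0) hs1) hr
        have h2 := mul_le_mul_of_nonneg_left
          (exp_sub_one_sub_le ((abs_neg s).trans (abs_of_nonneg hs0)) hs1) hr
        gcongr <;> linarith

/-- For `θ, ξ > 0`, `a_n → ∞`, `a_n/√n → 0` and `N_n` Poisson with mean `θ n`:
`limsup (1/a_n²) log P(|N_n - θn| > ξ a_n √n) ≤ -ξ²/(2θ)` (log 0 = -∞, in `EReal`). -/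
theorem stmt16 {Ω : Type*} [MeasureSpace Ω] [IsProbabilityMeasure (ℙ : Measure Ω)]
    (θ ξ : ℝ) (hθ : 0 < θ) (hξ : 0 < ξ)
    (a : ℕ → ℝ) (ha : ∀ n, 1 ≤ n → 0 < a n)
    (ha1 : Tendsto a atTop atTop)
    (ha2 : Tendsto (fun n => a n / Real.sqrt n) atTop (nhds 0))
    (N : ℕ → Ω → ℕ)
    (hN : ∀ n j : ℕ, ℙ {ω | N n ω = j} =
      ENNReal.ofReal (Real.exp (-(θ * n)) * (θ * n) ^ j / (Nat.factorial j))) :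
    limsup (fun n : ℕ => (((((a n) ^ 2)⁻¹ : ℝ) : EReal) *
        ENNReal.log (ℙ {ω | |((N n ω : ℝ)) - θ * n| > ξ * a n * Real.sqrt n}))) atTop ≤
      ((-ξ ^ 2 / (2 * θ) : ℝ) : EReal) := by
  set s : ℕ → ℝ := fun n => ξ / θ * (a n / Real.sqrt n)
  have hs : Tendsto s atTop (nhds 0) := by simpa using ha2.const_mul (ξ / θ)
  set b : ℕ → ℝ := fun n => ((a n) ^ 2)⁻¹ * Real.log 2 + -ξ ^ 2 / (2 * θ) * (1 - 2 * s n)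
  have hb : Tendsto b atTop (nhds (-ξ ^ 2 / (2 * θ))) := by
    have h1 : Tendsto (fun n => ((a n) ^ 2)⁻¹) atTop (nhds 0) :=
      ((tendsto_pow_atTop two_ne_zero).comp ha1).inv_tendsto_atTop
    have h2 := (h1.mul_const (Real.log 2)).add
      (((hs.const_mul 2).const_sub 1).const_mul (-ξ ^ 2 / (2 * θ)))
    simpa using h2
  have hb' : Tendsto (fun n => (b n : EReal)) atTop (nhds ((-ξ ^ 2 / (2 * θ) : ℝ) : EReal)) :=
    (continuous_coe_real_ereal.tendsto _).comp hb
  rw [← hb'.limsup_eq]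
  refine limsup_le_limsup ?_
  filter_upwards [eventually_ge_atTop 1, hs.eventually_le_const one_pos] with n hn hs1
  have han := ha n hn
  have hn0 : (0 : ℝ) < n := by exact_mod_cast hn
  have hsn : 0 ≤ s n := by positivity
  have hP := measure_abs_sub_gt_le_of_poisson ℙ (N n) (r := θ * n) (by positivity) hsn hs1
    (ξ * a n * Real.sqrt n) (hN n)
  have hlog := ENNReal.log_monotone hP
  rw [ENNReal.log_ofReal_of_pos (by positivity), Real.log_mul two_ne_zero (Real.exp_ne_zero _),
    Real.log_exp] at hlog
  refine (mul_le_mul_of_nonneg_left hlog (by positivity)).trans_eq ?_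
  rw [← EReal.coe_mul]
  congr 1
  have hq : Real.sqrt n ^ 2 = n := Real.sq_sqrt hn0.le
  have hq0 : 0 < Real.sqrt n := Real.sqrt_pos.2 hn0
  simp only [b, s]
  rw [← hq]
  simp only [Real.sqrt_sq hq0.le]
  field_simp
  ring
end
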